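/- Defocusing case on the line, vanishing non-attained ground state level: let p ∈ (2,6), α < 0 and μ ∈ (0, μ_ℝ]. Then ℰ_α(μ, ℝ) = 0, and the infimum is not achieved; more precisely, E_α(u) > 0 for every u ∈ H¹_μ(ℝ), while inf{E_α(u) : u ∈ H¹_μ(ℝ)} = 0. -/

import Mathlib

open MeasureTheory Real Set Filter

/-- Membership in `H¹(ℝ)`: `u` is differentiable with derivative `u'`,
and both `u` and `u'` are square-integrable on `ℝ`. -/
def H1line (u u' : ℝ → ℝ) : Prop :=
  (∀ x, HasDerivAt u (u' x) x) ∧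
  Integrable (fun x => (u x) ^ 2) ∧
  Integrable (fun x => (u' x) ^ 2)

/-- The NLS energy with combined nonlinearities
`E_α(u) = ∫_ℝ (½|u'|² − (1/6)|u|⁶ − (α/p)|u|^p)`. -/
noncomputable def Eline (p α : ℝ) (u u' : ℝ → ℝ) : ℝ :=
  ∫ x, (1 / 2 * (u' x) ^ 2 - 1 / 6 * |u x| ^ 6 - α / p * |u x| ^ p)

/-- The ground state energy level `ℰ_α(μ, ℝ) = inf {E_α(u) : u ∈ H¹_μ(ℝ)}`. -/
noncomputable def glevelLine (p α μ : ℝ) : ℝ :=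
  sInf {e : ℝ | ∃ u u' : ℝ → ℝ, H1line u u' ∧ (∫ x, (u x) ^ 2) = μ ∧ Eline p α u u' = e}

theorem H1line.integrable_mul {u u' : ℝ → ℝ} (h : H1line u u') :
    Integrable (fun x => u x * u' x) := by
  obtain ⟨hd, h0, h1⟩ := h
  have hu : Continuous u := continuous_iff_continuousAt.2 fun x => (hd x).continuousAt
  have hu' : Measurable u' := by
    have : u' = deriv u := funext fun x => (hd x).deriv.symm
    rw [this]; exact measurable_deriv u
  refine (h0.add h1).mono' (hu.measurable.mul hu').aestronglyMeasurable (ae_of_all _ fun x => ?_)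
  simp only [Pi.add_apply, Real.norm_eq_abs]
  exact abs_le.2 ⟨by nlinarith [sq_nonneg (u x + u' x), sq_nonneg (u x), sq_nonneg (u' x)],
    by nlinarith [sq_nonneg (u x - u' x), sq_nonneg (u x), sq_nonneg (u' x)]⟩

theorem H1line.continuous {u u' : ℝ → ℝ} (h : H1line u u') : Continuous u :=
  continuous_iff_continuousAt.2 fun x => (h.1 x).continuousAt

theorem H1line.exists_bound {u u' : ℝ → ℝ} (h : H1line u u') :
    ∃ C : ℝ, 0 < C ∧ ∀ x, |u x| ≤ C := by
  have hi := h.integrable_mul.const_mul 2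
  have key : ∀ x, u x ^ 2 ≤ u 0 ^ 2 + ∫ y, |2 * (u y * u' y)| := fun x => by
    have h1 : ∫ y in (0 : ℝ)..x, 2 * (u y * u' y) = u x ^ 2 - u 0 ^ 2 := by
      refine intervalIntegral.integral_eq_sub_of_hasDerivAt (f := fun y => u y ^ 2)
        (fun y _ => ?_) hi.intervalIntegrable
      exact ((h.1 y).pow 2).congr_deriv (by push_cast; ring)
    have h2 := intervalIntegral.norm_integral_le_integral_norm_uIoc (μ := volume)
      (f := fun y => 2 * (u y * u' y)) (a := 0) (b := x)
    have h3 : ∫ y in Set.uIoc 0 x, ‖2 * (u y * u' y)‖ ≤ ∫ y, ‖2 * (u y * u' y)‖ :=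
      setIntegral_le_integral hi.norm (ae_of_all _ fun y => norm_nonneg _)
    simp only [Real.norm_eq_abs] at h2 h3
    rw [h1] at h2
    linarith [le_abs_self (u x ^ 2 - u 0 ^ 2)]
  set K := u 0 ^ 2 + ∫ y, |2 * (u y * u' y)| with hK
  refine ⟨K + 1, ?_, fun x => ?_⟩
  · linarith [key 0, sq_nonneg (u 0)]
  · have := key x
    rw [← sq_abs] at this
    nlinarith [sq_nonneg (|u x| - 1), abs_nonneg (u x)]

theorem H1line.integrable_rpow {u u' : ℝ → ℝ} (h : H1line u u') {q : ℝ} (hq : 2 ≤ q) :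
    Integrable (fun x => |u x| ^ q) := by
  obtain ⟨C, hC, hb⟩ := h.exists_bound
  refine (h.2.1.const_mul (C ^ (q - 2))).mono'
    ((h.continuous.abs.rpow_const fun x => Or.inr (by linarith)).aestronglyMeasurable)
    (ae_of_all _ fun x => ?_)
  rw [Real.norm_of_nonneg (by positivity)]
  rcases eq_or_ne (u x) 0 with h0 | h0
  · simp [h0, Real.zero_rpow (by linarith : q ≠ 0)]
  · have h1 : |u x| ^ q = |u x| ^ (q - 2) * u x ^ 2 := by
      rw [← sq_abs, ← Real.rpow_natCast, ← Real.rpow_add (abs_pos.2 h0)]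
      norm_num
    rw [h1]
    exact mul_le_mul_of_nonneg_right
      (Real.rpow_le_rpow (abs_nonneg _) (hb x) (by linarith)) (sq_nonneg _)

theorem H1line.integrable_pow_six {u u' : ℝ → ℝ} (h : H1line u u') :
    Integrable (fun x => |u x| ^ 6) := by
  have := h.integrable_rpow (q := 6) (by norm_num)
  refine this.congr (ae_of_all _ fun x => ?_)
  exact_mod_cast Real.rpow_natCast |u x| 6

/-- For `k < π / (2 μ)` the inequality follows from integrating the square of
`u' + k u³ tan θ`, where `θ' = 2 k u²`. -/
theorem H1line.mul_integral_pow_six_le {u u' : ℝ → ℝ} (h : H1line u u') {k : ℝ} (hk : 0 < k)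
    (hkμ : k * ∫ x, (u x) ^ 2 < π / 2) :
    k ^ 2 * ∫ x, |u x| ^ 6 ≤ ∫ x, (u' x) ^ 2 := by
  set μ := ∫ x, (u x) ^ 2 with hμ
  have hcont := h.continuous
  have hcont2 : Continuous fun x => u x ^ 2 := hcont.pow 2
  have hμ0 : 0 ≤ μ := integral_nonneg fun x => sq_nonneg _
  set θ : ℝ → ℝ := fun x => 2 * k * ((∫ t in Set.Iic x, u t ^ 2) - μ / 2) with hθ
  have hM0 : ∀ x, 0 ≤ ∫ t in Set.Iic x, u t ^ 2 := fun x => integral_nonneg fun x => sq_nonneg _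
  have hM1 : ∀ x, ∫ t in Set.Iic x, u t ^ 2 ≤ μ := fun x =>
    setIntegral_le_integral h.2.1 (ae_of_all _ fun y => sq_nonneg _)
  have hθd : ∀ x, HasDerivAt θ (2 * k * u x ^ 2) x := fun x => by
    have hM : (fun x => ∫ t in Set.Iic x, u t ^ 2) =
        fun x => (∫ t in (0 : ℝ)..x, u t ^ 2) + ∫ t in Set.Iic 0, u t ^ 2 := by
      funext x
      have := intervalIntegral.integral_Iic_sub_Iic (f := fun t => u t ^ 2) (μ := volume)
        (a := 0) (b := x) h.2.1.integrableOn h.2.1.integrableOn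
      linarith
    have h1 : HasDerivAt (fun x => ∫ t in Set.Iic x, u t ^ 2) (u x ^ 2) x := by
      rw [hM]
      exact (intervalIntegral.integral_hasDerivAt_right h.2.1.intervalIntegrable
        hcont2.stronglyMeasurable.stronglyMeasurableAtFilter hcont2.continuousAt).add_const _
    exact (h1.sub_const _).const_mul _
  have hθb : ∀ x, θ x ∈ Set.Icc (-(k * μ)) (k * μ) := fun x => by
    simp only [hθ, Set.mem_Icc]
    constructor <;> nlinarith [hM0 x, hM1 x]
  have hcos : ∀ x, 0 < Real.cos (θ x) := fun x =>
    Real.cos_pos_of_mem_Ioo ⟨by linarith [(hθb x).1], by linarith [(hθb x).2]⟩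
  have hTb : ∀ x, |Real.tan (θ x)| ≤ Real.tan (k * μ) := fun x => by
    have hmono := Real.strictMonoOn_tan.monotoneOn
    have hm : θ x ∈ Set.Ioo (-(π / 2)) (π / 2) :=
      ⟨by linarith [(hθb x).1], by linarith [(hθb x).2]⟩
    have hkμ0 : 0 ≤ k * μ := by positivity
    have hp : k * μ ∈ Set.Ioo (-(π / 2)) (π / 2) := ⟨by linarith [Real.pi_pos], hkμ⟩
    have hn : -(k * μ) ∈ Set.Ioo (-(π / 2)) (π / 2) := ⟨by linarith, by linarith [Real.pi_pos]⟩
    refine abs_le.2 ⟨?_, hmono hm hp (hθb x).2⟩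
    rw [← Real.tan_neg]
    exact hmono hn hm (hθb x).1
  set T : ℝ → ℝ := fun x => Real.tan (θ x) with hT
  have hTd : ∀ x, HasDerivAt T ((1 + T x ^ 2) * (2 * k * u x ^ 2)) x := fun x => by
    refine ((Real.hasDerivAt_tan (hcos x).ne').comp x (hθd x)).congr_deriv ?_
    simp only [hT, Real.tan_eq_sin_div_cos]
    have := (hcos x).ne'
    have h2 := Real.sin_sq_add_cos_sq (θ x)
    field_simp
    linear_combination -(u x ^ 2) * h2
  have hTc : Continuous T := continuous_iff_continuousAt.2 fun x => (hTd x).continuousAt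
  obtain ⟨C, hC, hb⟩ := h.exists_bound
  have h6 := h.integrable_pow_six
  have h6' : Integrable (fun x => u x ^ 6) := by
    refine h6.congr (ae_of_all _ fun x => ?_)
    exact Even.pow_abs (by decide) _
  have h4 : Integrable (fun x => u x ^ 4) := by
    refine (h.2.1.bdd_mul (c := C ^ 2) hcont2.aestronglyMeasurable
      (ae_of_all _ fun x => ?_)).congr (ae_of_all _ fun x => ?_)
    · rw [norm_pow]; exact pow_le_pow_left₀ (abs_nonneg _) (hb x) 2
    · simp only; ring
  have h4T : Integrable (fun x => T x * u x ^ 4) :=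
    h4.bdd_mul hTc.aestronglyMeasurable (ae_of_all _ hTb)
  have h3T : Integrable (fun x => (T x * u x ^ 2) * (u x * u' x)) := by
    refine h.integrable_mul.bdd_mul (c := Real.tan (k * μ) * C ^ 2)
      (hTc.mul hcont2).aestronglyMeasurable (ae_of_all _ fun x => ?_)
    rw [norm_mul, norm_pow]
    exact mul_le_mul (hTb x) (pow_le_pow_left₀ (abs_nonneg _) (hb x) 2) (by positivity)
      ((abs_nonneg _).trans (hTb x))
  have h6T : Integrable (fun x => T x ^ 2 * u x ^ 6) := by
    refine h6'.bdd_mul (c := Real.tan (k * μ) ^ 2) (hTc.pow 2).aestronglyMeasurable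
      (ae_of_all _ fun x => ?_)
    rw [norm_pow]; exact pow_le_pow_left₀ (abs_nonneg _) (hTb x) 2
  have hI : Integrable (fun x => 4 * ((T x * u x ^ 2) * (u x * u' x))
      + 2 * k * (u x ^ 6 + T x ^ 2 * u x ^ 6)) :=
    (h3T.const_mul 4).add ((h6'.add h6T).const_mul (2 * k))
  have hzero : ∫ x, (4 * ((T x * u x ^ 2) * (u x * u' x))
      + 2 * k * (u x ^ 6 + T x ^ 2 * u x ^ 6)) = 0 := by
    refine integral_eq_zero_of_hasDerivAt_of_integrable (f := fun x => T x * u x ^ 4)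
      (fun x => ?_) hI h4T
    refine ((hTd x).mul ((h.1 x).pow 4)).congr_deriv ?_
    push_cast; simp only [Pi.pow_apply]; ring
  have hsq : 0 ≤ ∫ x, (u' x + k * u x ^ 3 * T x) ^ 2 := integral_nonneg fun x => sq_nonneg _
  have hexp : ∫ x, (u' x + k * u x ^ 3 * T x) ^ 2 =
      ∫ x, ((u' x ^ 2 - k ^ 2 * |u x| ^ 6) + k / 2 * (4 * ((T x * u x ^ 2) * (u x * u' x))
      + 2 * k * (u x ^ 6 + T x ^ 2 * u x ^ 6))) := by
    congr 1; funext x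
    rw [Even.pow_abs (by decide)]; ring
  have hsub : Integrable (fun x => u' x ^ 2 - k ^ 2 * |u x| ^ 6) := h.2.2.sub (h6.const_mul _)
  rw [hexp, integral_add hsub (hI.const_mul _),
    integral_sub h.2.2 (h6.const_mul _), integral_const_mul, integral_const_mul, hzero] at hsq
  linarith

/-- The sharp Gagliardo–Nirenberg inequality on the line, at mass at most `π √3 / 2`. -/
theorem H1line.integral_pow_six_le {u u' : ℝ → ℝ} (h : H1line u u')
    (hμ0 : 0 < ∫ x, (u x) ^ 2) (hμ : ∫ x, (u x) ^ 2 ≤ π * √3 / 2) :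
    1 / 3 * ∫ x, |u x| ^ 6 ≤ ∫ x, (u' x) ^ 2 := by
  set k₀ : ℝ := 1 / √3 with hk₀
  have h3 : 0 < √3 := by positivity
  have hk₀' : 0 < k₀ := by positivity
  have hsq : k₀ ^ 2 = 1 / 3 := by rw [hk₀, div_pow, Real.sq_sqrt (by norm_num)]; norm_num
  have hle : k₀ * ∫ x, (u x) ^ 2 ≤ π / 2 := by
    calc k₀ * ∫ x, (u x) ^ 2 ≤ k₀ * (π * √3 / 2) := by gcongr
      _ = π / 2 := by rw [hk₀]; field_simp
  rw [← hsq]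
  have ht : Tendsto (fun k : ℝ => k ^ 2 * ∫ x, |u x| ^ 6) (nhdsWithin k₀ (Set.Iio k₀))
      (nhds (k₀ ^ 2 * ∫ x, |u x| ^ 6)) :=
    (Continuous.tendsto (by fun_prop) k₀).mono_left nhdsWithin_le_nhds
  refine le_of_tendsto ht ?_
  filter_upwards [Ioo_mem_nhdsLT hk₀'] with k hk
  exact h.mul_integral_pow_six_le hk.1 ((mul_lt_mul_of_pos_right hk.2 hμ0).trans_le hle)

theorem H1line.eline_eq {u u' : ℝ → ℝ} (h : H1line u u') {p : ℝ} (hp : 2 ≤ p) (α : ℝ) :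
    Eline p α u u' = 1 / 2 * (∫ x, (u' x) ^ 2) - 1 / 6 * (∫ x, |u x| ^ 6)
      - α / p * ∫ x, |u x| ^ p := by
  have h1 := h.2.2.const_mul (1 / 2)
  have h2 := h.integrable_pow_six.const_mul (1 / 6)
  have h3 := (h.integrable_rpow hp).const_mul (α / p)
  have h12 : Integrable (fun x => 1 / 2 * (u' x) ^ 2 - 1 / 6 * |u x| ^ 6) := h1.sub h2
  rw [Eline, integral_sub h12 h3, integral_sub h1 h2]
  simp only [integral_const_mul]

theorem H1line.eline_pos {u u' : ℝ → ℝ} (h : H1line u u') {p α : ℝ} (hp : 2 < p) (hα : α < 0)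
    (hμ0 : 0 < ∫ x, (u x) ^ 2) (hμ : ∫ x, (u x) ^ 2 ≤ π * √3 / 2) : 0 < Eline p α u u' := by
  have hpos : 0 < ∫ x, |u x| ^ p := by
    refine (integral_nonneg fun x => by positivity).lt_of_ne' fun h0 => hμ0.ne' ?_
    rw [integral_eq_zero_iff_of_nonneg (fun x => by positivity) (h.integrable_rpow hp.le)] at h0
    refine integral_eq_zero_of_ae ?_
    filter_upwards [h0] with x hx
    have := (Real.rpow_eq_zero (abs_nonneg (u x)) (by linarith : p ≠ 0)).1 hx
    simp [abs_eq_zero.1 this]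
  have hGN := h.integral_pow_six_le hμ0 hμ
  have hc : α / p < 0 := div_neg_of_neg_of_pos hα (by linarith)
  rw [h.eline_eq hp.le]
  nlinarith [mul_neg_of_neg_of_pos hc hpos]

theorem exists_H1line_integral_sq_eq {μ : ℝ} (hμ : 0 ≤ μ) :
    ∃ v v' : ℝ → ℝ, H1line v v' ∧ ∫ x, (v x) ^ 2 = μ := by
  set m : ℝ := √(π / 2) with hm
  have hm0 : 0 < m := by positivity
  have hexp : ∀ x : ℝ, Real.exp (-x ^ 2) ^ 2 = Real.exp (-2 * x ^ 2) := fun x => by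
    rw [← Real.exp_nat_mul]; congr 1; push_cast; ring
  have hsq : √(μ / m) ^ 2 = μ / m := Real.sq_sqrt (by positivity)
  have hv : ∀ x, (√(μ / m) * Real.exp (-x ^ 2)) ^ 2 = μ / m * Real.exp (-2 * x ^ 2) := fun x => by
    rw [mul_pow, hsq, hexp]
  refine ⟨fun x => √(μ / m) * Real.exp (-x ^ 2),
    fun x => √(μ / m) * (Real.exp (-x ^ 2) * (-(2 * x))), ⟨fun x => ?_, ?_, ?_⟩, ?_⟩
  · have h := ((hasDerivAt_pow 2 x).neg.exp).const_mul √(μ / m)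
    simpa using h
  · simp only [hv]
    exact (integrable_exp_neg_mul_sq two_pos).const_mul _
  · have h := (integrable_rpow_mul_exp_neg_mul_sq two_pos (s := 2) (by norm_num)).const_mul
      (4 * (μ / m))
    refine h.congr (ae_of_all _ fun x => ?_)
    simp only [Real.rpow_two]
    rw [mul_pow, mul_pow, hsq, hexp]; ring
  · simp only [hv]
    rw [integral_const_mul, integral_gaussian, div_mul_cancel₀ _ hm0.ne']

theorem integral_comp_sq_mul (f : ℝ → ℝ) (s : ℝ) :
    ∫ x, f (s ^ 2 * x) = (s ^ 2)⁻¹ * ∫ x, f x := by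
  rw [Measure.integral_comp_mul_left, abs_of_nonneg (by positivity), smul_eq_mul]

theorem H1line.dilation {v v' : ℝ → ℝ} (h : H1line v v') {s : ℝ} (hs : 0 < s) :
    H1line (fun x => s * v (s ^ 2 * x)) (fun x => s ^ 3 * v' (s ^ 2 * x)) := by
  have hs2 : s ^ 2 ≠ 0 := by positivity
  refine ⟨fun x => ?_, ?_, ?_⟩
  · exact (((h.1 (s ^ 2 * x)).comp x ((hasDerivAt_id x).const_mul (s ^ 2))).const_mul
      s).congr_deriv (by ring)
  · simp only [mul_pow]
    exact (h.2.1.comp_mul_left' hs2).const_mul _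
  · simp only [mul_pow]
    exact (h.2.2.comp_mul_left' hs2).const_mul _

theorem integral_sq_dilation (v : ℝ → ℝ) {s : ℝ} (hs : 0 < s) :
    ∫ x, (s * v (s ^ 2 * x)) ^ 2 = ∫ x, (v x) ^ 2 := by
  simp only [mul_pow]
  rw [integral_const_mul, integral_comp_sq_mul (fun x => v x ^ 2)]
  field_simp

theorem H1line.eline_dilation {v v' : ℝ → ℝ} (h : H1line v v') {p : ℝ} (hp : 2 ≤ p) (α : ℝ)
    {s : ℝ} (hs : 0 < s) :
    Eline p α (fun x => s * v (s ^ 2 * x)) (fun x => s ^ 3 * v' (s ^ 2 * x)) =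
      s ^ 4 * (1 / 2 * (∫ x, (v' x) ^ 2) - 1 / 6 * ∫ x, |v x| ^ 6)
        - s ^ (p - 2) * (α / p * ∫ x, |v x| ^ p) := by
  rw [(h.dilation hs).eline_eq hp]
  simp only [mul_pow, abs_mul, abs_of_pos hs, Real.mul_rpow hs.le (abs_nonneg _),
    integral_const_mul]
  rw [integral_comp_sq_mul (fun x => v' x ^ 2), integral_comp_sq_mul (fun x => |v x| ^ 6),
    integral_comp_sq_mul (fun x => |v x| ^ p), Real.rpow_sub hs, Real.rpow_two]
  field_simp

/-- Defocusing case on the line: for `p ∈ (2,6)`, `α < 0` and `μ ∈ (0, μ_ℝ]`,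
`E_α(u) > 0` for every `u ∈ H¹_μ(ℝ)`, while the infimum `ℰ_α(μ, ℝ)` equals `0`
(so it is not achieved). -/
theorem defocusing_level_zero_not_attained_line (p α μ : ℝ)
    (hp : 2 < p) (hp' : p < 6) (hα : α < 0)
    (hμ : 0 < μ) (hμR : μ ≤ Real.pi * Real.sqrt 3 / 2) :
    (∀ u u' : ℝ → ℝ, H1line u u' → (∫ x, (u x) ^ 2) = μ → 0 < Eline p α u u') ∧
      glevelLine p α μ = 0 := by
  have hpos : ∀ u u' : ℝ → ℝ, H1line u u' → (∫ x, (u x) ^ 2) = μ → 0 < Eline p α u u' :=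
    fun u u' h hm => h.eline_pos hp hα (hm ▸ hμ) (hm ▸ hμR)
  refine ⟨hpos, le_antisymm ?_ ?_⟩
  · obtain ⟨v, v', h, hm⟩ := exists_H1line_integral_sq_eq hμ.le
    have ht : Tendsto (fun s : ℝ =>
        s ^ 4 * (1 / 2 * (∫ x, (v' x) ^ 2) - 1 / 6 * ∫ x, |v x| ^ 6)
          - s ^ (p - 2) * (α / p * ∫ x, |v x| ^ p)) (nhdsWithin 0 (Set.Ioi 0)) (nhds 0) := by
      have hc : ContinuousAt (fun s : ℝ =>
          s ^ 4 * (1 / 2 * (∫ x, (v' x) ^ 2) - 1 / 6 * ∫ x, |v x| ^ 6)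
            - s ^ (p - 2) * (α / p * ∫ x, |v x| ^ p)) 0 :=
        ((continuousAt_id.pow 4).mul_const _).sub
          ((Real.continuousAt_rpow_const 0 (p - 2) (Or.inr (by linarith))).mul_const _)
      have := hc.tendsto.mono_left (nhdsWithin_le_nhds (s := Set.Ioi 0))
      simpa [Real.zero_rpow (by linarith : p - 2 ≠ 0)] using this
    refine ge_of_tendsto ht ?_
    filter_upwards [self_mem_nhdsWithin] with s hs
    refine csInf_le ⟨0, ?_⟩ ⟨_, _, h.dilation hs, (integral_sq_dilation v hs).trans hm,
      h.eline_dilation hp.le α hs⟩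
    rintro e ⟨u, u', hu, hum, rfl⟩
    exact (hpos u u' hu hum).le
  · refine Real.sInf_nonneg ?_
    rintro e ⟨u, u', hu, hum, rfl⟩
    exact (hpos u u' hu hum).le
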